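/- arXiv:1809.00948 — 2 statements merged into one kernel-verified Lean document; each statement's English description precedes it below -/
import Mathlib

section
/- Let (Ω, 𝒜, μ) be a probability space, let E be a separable Banach space equipped with its Borel σ-algebra, let 𝕏 be a standard Borel space, and let X : Ω → 𝕏 and Y : Ω → E be measurable. Let Π : E → E be a measurable map whose range is a closed subset of E, let F be a standard Borel space, and let B : E → F be measurable and injective on the range of Π. Then the following are equivalent: (i) for every bounded measurable f : 𝕏 → ℝ one has μ[f ∘ X | σ(Y)] = μ[f ∘ X | σ(B ∘ Π ∘ Y)] μ-almost surely; (ii) X and the random variable ω ↦ Y(ω) − Π(Y(ω)) are conditionally independent given the random variable ω ↦ Π(Y(ω)). -/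
open MeasureTheory ProbabilityTheory

theorem MeasurableSpace.comap_comp_eq_of_injOn {Ω E F : Type*} [MeasurableSpace E]
    [StandardBorelSpace E] [MeasurableSpace F] [MeasurableSpace.CountablySeparated F]
    {B : E → F} {s : Set E} {Z : Ω → E} (hs : MeasurableSet s) (hB : Measurable B)
    (hinj : Set.InjOn B s) (hZ : ∀ ω, Z ω ∈ s) :
    MeasurableSpace.comap (fun ω => B (Z ω)) inferInstance
      = MeasurableSpace.comap Z inferInstance := by
  apply le_antisymm
  · rintro _ ⟨t, ht, rfl⟩
    exact ⟨B ⁻¹' t, hB ht, rfl⟩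
  · rintro _ ⟨t, ht, rfl⟩
    refine ⟨B '' (t ∩ s),
      (ht.inter hs).image_of_measurable_injOn hB (hinj.mono Set.inter_subset_right), ?_⟩
    ext ω
    constructor
    · rintro ⟨x, ⟨hxt, hxs⟩, hx⟩
      have hxZ : x = Z ω := hinj hxs (hZ ω) hx
      rwa [Set.mem_preimage, ← hxZ]
    · intro hω
      exact ⟨Z ω, ⟨hω, hZ ω⟩, rfl⟩

theorem MeasurableSpace.comap_sup_comap_sub {Ω E : Type*} [AddGroup E] [MeasurableSpace E]
    [MeasurableAdd₂ E] [MeasurableSub₂ E] (Y : Ω → E) {P : E → E} (hP : Measurable P) :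
    MeasurableSpace.comap (fun ω => P (Y ω)) inferInstance
      ⊔ MeasurableSpace.comap (fun ω => Y ω - P (Y ω)) inferInstance
      = MeasurableSpace.comap Y inferInstance := by
  apply le_antisymm
  · have hY : Measurable[MeasurableSpace.comap Y inferInstance] Y := comap_measurable Y
    exact sup_le (hP.comp hY).comap_le (hY.sub (hP.comp hY)).comap_le
  · let m := MeasurableSpace.comap (fun ω => P (Y ω)) inferInstance
      ⊔ MeasurableSpace.comap (fun ω => Y ω - P (Y ω)) inferInstance
    have h₁ : Measurable[m] fun ω => P (Y ω) :=
      (comap_measurable _).mono le_sup_left le_rfl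
    have h₂ : Measurable[m] fun ω => Y ω - P (Y ω) :=
      (comap_measurable _).mono le_sup_right le_rfl
    have h : Measurable[m] Y := by simpa [Pi.add_def] using h₂.add h₁
    exact h.comap_le

theorem MeasurableSpace.generateFrom_image2_inter {Ω : Type*} (m₁ m₂ : MeasurableSpace Ω) :
    MeasurableSpace.generateFrom
      (Set.image2 (· ∩ ·) {u | MeasurableSet[m₁] u} {t | MeasurableSet[m₂] t}) = m₁ ⊔ m₂ := by
  apply le_antisymm
  · refine MeasurableSpace.generateFrom_le ?_
    rintro _ ⟨u, hu, t, ht, rfl⟩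
    exact MeasurableSet.inter (le_sup_left (a := m₁) (b := m₂) u hu)
      (le_sup_right (a := m₁) (b := m₂) t ht)
  · refine sup_le (fun u hu => ?_) (fun t ht => ?_)
    · exact MeasurableSpace.measurableSet_generateFrom
        ⟨u, hu, Set.univ, MeasurableSet.univ, Set.inter_univ u⟩
    · exact MeasurableSpace.measurableSet_generateFrom
        ⟨Set.univ, MeasurableSet.univ, t, ht, Set.univ_inter t⟩

theorem MeasurableSpace.isPiSystem_image2_inter {Ω : Type*} (m₁ m₂ : MeasurableSpace Ω) :
    IsPiSystem (Set.image2 (· ∩ ·) {u | MeasurableSet[m₁] u} {t | MeasurableSet[m₂] t}) := by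
  rintro _ ⟨u, hu, t, ht, rfl⟩ _ ⟨u', hu', t', ht', rfl⟩ -
  exact ⟨u ∩ u', MeasurableSet.inter hu hu', t ∩ t', MeasurableSet.inter ht ht',
    Set.inter_inter_inter_comm u u' t t'⟩

section CondExp

variable {Ω : Type*} {m m₂ mΩ : MeasurableSpace Ω} {μ : Measure Ω} {g h : Ω → ℝ}

theorem setIntegral_eq_of_inter (hm : m ≤ mΩ) (hm₂ : m₂ ≤ mΩ) (hg : Integrable g μ)
    (hh : Integrable h μ)
    (H : ∀ u t, MeasurableSet[m] u → MeasurableSet[m₂] t →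
      ∫ ω in u ∩ t, g ω ∂μ = ∫ ω in u ∩ t, h ω ∂μ)
    {s : Set Ω} (hs : MeasurableSet[m ⊔ m₂] s) :
    ∫ ω in s, g ω ∂μ = ∫ ω in s, h ω ∂μ := by
  have hle : m ⊔ m₂ ≤ mΩ := sup_le hm hm₂
  refine MeasurableSpace.induction_on_inter (m := m ⊔ m₂)
    (C := fun s _ => ∫ ω in s, g ω ∂μ = ∫ ω in s, h ω ∂μ)
    (MeasurableSpace.generateFrom_image2_inter m m₂).symm
    (MeasurableSpace.isPiSystem_image2_inter m m₂) (by simp) ?_ ?_ ?_ s hs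
  · rintro _ ⟨u, hu, t, ht, rfl⟩
    exact H u t hu ht
  · intro t ht ih
    have huniv : ∫ ω, g ω ∂μ = ∫ ω, h ω ∂μ := by
      simpa using H Set.univ Set.univ MeasurableSet.univ MeasurableSet.univ
    rw [setIntegral_compl (hle t ht) hg, setIntegral_compl (hle t ht) hh, ih, huniv]
  · intro f hdisj hf ih
    rw [integral_iUnion (fun i => hle _ (hf i)) hdisj hg.integrableOn,
      integral_iUnion (fun i => hle _ (hf i)) hdisj hh.integrableOn]
    exact tsum_congr ih

theorem mul_indicator_one_eq_indicator (t : Set Ω) (g : Ω → ℝ) :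
    g * t.indicator (fun _ => (1 : ℝ)) = t.indicator g := by
  ext ω
  by_cases hω : ω ∈ t <;> simp [hω]

variable [IsFiniteMeasure μ]

theorem condExp_sup_eq_of_forall_condExp_mul_indicator (hm : m ≤ mΩ) (hm₂ : m₂ ≤ mΩ)
    (hh : Integrable h μ)
    (H : ∀ t, MeasurableSet[m₂] t →
      μ[h * t.indicator (fun _ => (1 : ℝ)) | m] =ᵐ[μ] μ[h | m] * μ⟦t | m⟧) :
    μ[h | m ⊔ m₂] =ᵐ[μ] μ[h | m] := by
  symm
  refine ae_eq_condExp_of_forall_setIntegral_eq (sup_le hm hm₂) hh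
    (fun _ _ _ => integrable_condExp.integrableOn) (fun s hs _ => ?_)
    ((stronglyMeasurable_condExp (m := m)).mono
      (le_sup_left : m ≤ m ⊔ m₂)).aestronglyMeasurable
  refine setIntegral_eq_of_inter hm hm₂ integrable_condExp hh (fun u t hu ht => ?_) hs
  have htΩ := hm₂ t ht
  have hi₁ : Integrable (μ[h | m] * t.indicator fun _ => (1 : ℝ)) μ := by
    rw [mul_indicator_one_eq_indicator]
    exact integrable_condExp.indicator htΩ
  have hi₂ : Integrable (h * t.indicator fun _ => (1 : ℝ)) μ := by
    rw [mul_indicator_one_eq_indicator]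
    exact hh.indicator htΩ
  have hpull : μ[μ[h | m] * t.indicator (fun _ => (1 : ℝ)) | m]
      =ᵐ[μ] μ[h * t.indicator (fun _ => (1 : ℝ)) | m] :=
    (condExp_mul_of_stronglyMeasurable_left stronglyMeasurable_condExp hi₁
      ((integrable_const (1 : ℝ)).indicator htΩ)).trans (H t ht).symm
  rw [← setIntegral_indicator htΩ, ← setIntegral_indicator htΩ,
    ← mul_indicator_one_eq_indicator t (μ[h | m]), ← mul_indicator_one_eq_indicator t h,
    ← setIntegral_condExp hm hi₁ hu, ← setIntegral_condExp hm hi₂ hu]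
  exact setIntegral_congr_ae (hm u hu) (hpull.mono fun _ hω _ => hω)

theorem condExp_mul_eq_mul_condExp_of_condExp_sup_eq (hm : m ≤ mΩ) (hm₂ : m₂ ≤ mΩ)
    (hg : Integrable g μ) (hh : StronglyMeasurable[m₂] h) {C : ℝ} (hC : ∀ ω, |h ω| ≤ C)
    (H : μ[g | m ⊔ m₂] =ᵐ[μ] μ[g | m]) :
    μ[g * h | m] =ᵐ[μ] μ[g | m] * μ[h | m] := by
  have hle : m ⊔ m₂ ≤ mΩ := sup_le hm hm₂
  have hhΩ : AEStronglyMeasurable h μ := (hh.mono hm₂).aestronglyMeasurable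
  have hhi : Integrable h μ := .of_bound hhΩ C (.of_forall hC)
  have hpull : μ[g * h | m ⊔ m₂] =ᵐ[μ] μ[g | m] * h :=
    (condExp_mul_of_stronglyMeasurable_right (hh.mono (le_sup_right : m₂ ≤ m ⊔ m₂))
      (hg.mul_bdd hhΩ (.of_forall hC)) hg).trans (H.mul .rfl)
  calc μ[g * h | m]
      =ᵐ[μ] μ[μ[g * h | m ⊔ m₂] | m] := (condExp_condExp_of_le le_sup_left hle).symm
    _ =ᵐ[μ] μ[μ[g | m] * h | m] := condExp_congr_ae hpull
    _ =ᵐ[μ] μ[g | m] * μ[h | m] :=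
      condExp_mul_of_stronglyMeasurable_left stronglyMeasurable_condExp
        (integrable_condExp.mul_bdd hhΩ (.of_forall hC)) hhi

end CondExp

theorem indicator_one_mul_indicator_one {Ω : Type*} (s t : Set Ω) :
    s.indicator (fun _ => (1 : ℝ)) * t.indicator (fun _ => (1 : ℝ))
      = (s ∩ t).indicator fun _ => (1 : ℝ) := by
  rw [mul_indicator_one_eq_indicator, Set.indicator_indicator, Set.inter_comm]

theorem abs_indicator_one_le_one {Ω : Type*} (s : Set Ω) (ω : Ω) :
    |s.indicator (fun _ => (1 : ℝ)) ω| ≤ 1 := by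
  by_cases hω : ω ∈ s <;> simp [hω]

section CondIndep

variable {Ω : Type*} {m m₁ m₂ mΩ : MeasurableSpace Ω} [StandardBorelSpace Ω] {μ : Measure Ω}
  [IsFiniteMeasure μ]

theorem condIndep_of_forall_condExp_sup_eq (hm : m ≤ mΩ) (hm₁ : m₁ ≤ mΩ) (hm₂ : m₂ ≤ mΩ)
    (H : ∀ s, MeasurableSet[m₁] s → μ⟦s | m ⊔ m₂⟧ =ᵐ[μ] μ⟦s | m⟧) :
    CondIndep m m₁ m₂ hm μ := by
  rw [condIndep_iff m m₁ m₂ hm hm₁ hm₂]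
  intro s t hs ht
  rw [← indicator_one_mul_indicator_one]
  exact condExp_mul_eq_mul_condExp_of_condExp_sup_eq hm hm₂
    ((integrable_const (1 : ℝ)).indicator (hm₁ s hs)) (stronglyMeasurable_const.indicator ht)
    (abs_indicator_one_le_one t) (H s hs)

theorem ProbabilityTheory.CondIndep.condExp_indicator_sup_eq {hm : m ≤ mΩ}
    (hind : CondIndep m m₁ m₂ hm μ) (hm₁ : m₁ ≤ mΩ) (hm₂ : m₂ ≤ mΩ) {s : Set Ω}
    (hs : MeasurableSet[m₁] s) : μ⟦s | m ⊔ m₂⟧ =ᵐ[μ] μ⟦s | m⟧ := by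
  refine condExp_sup_eq_of_forall_condExp_mul_indicator hm hm₂
    ((integrable_const (1 : ℝ)).indicator (hm₁ s hs)) fun t ht => ?_
  rw [indicator_one_mul_indicator_one]
  exact (condIndep_iff m m₁ m₂ hm hm₁ hm₂ μ).1 hind s t hs ht

theorem ProbabilityTheory.CondIndep.condExp_sup_eq {hm : m ≤ mΩ}
    (hind : CondIndep m m₁ m₂ hm μ) (hm₁ : m₁ ≤ mΩ) (hm₂ : m₂ ≤ mΩ) {h : Ω → ℝ}
    (hh : StronglyMeasurable[m₁] h) {C : ℝ} (hC : ∀ ω, |h ω| ≤ C) :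
    μ[h | m ⊔ m₂] =ᵐ[μ] μ[h | m] := by
  refine condExp_sup_eq_of_forall_condExp_mul_indicator hm hm₂
    (.of_bound (hh.mono hm₁).aestronglyMeasurable C (.of_forall hC)) fun t ht => ?_
  rw [mul_comm h, mul_comm (μ[h | m])]
  exact condExp_mul_eq_mul_condExp_of_condExp_sup_eq hm hm₁
    ((integrable_const (1 : ℝ)).indicator (hm₂ t ht)) hh hC
    (hind.symm.condExp_indicator_sup_eq hm₂ hm₁ ht)

end CondIndep

/-- **Proposition 7.1.** Let `(Ω, 𝒜, μ)` be a probability space, `E` a separable Banach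
space with its Borel σ-algebra, `𝕏` a standard Borel space, and `X : Ω → 𝕏`, `Y : Ω → E`
measurable. Let `P : E → E` be measurable with closed range, `F` a standard Borel space, and
`B : E → F` measurable and injective on the range of `P`. Then
`μ[f ∘ X | σ(Y)] = μ[f ∘ X | σ(B ∘ P ∘ Y)]` a.s. for every bounded measurable `f` iff
`X` and `Y - P ∘ Y` are conditionally independent given `P ∘ Y`. -/
theorem prop_7_1 {Ω 𝕏 E F : Type*}
    [MeasurableSpace Ω] [StandardBorelSpace Ω]
    [MeasurableSpace 𝕏] [StandardBorelSpace 𝕏]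
    [NormedAddCommGroup E] [NormedSpace ℝ E] [CompleteSpace E]
    [SecondCountableTopology E]
    [MeasurableSpace E] [BorelSpace E]
    [MeasurableSpace F] [StandardBorelSpace F]
    (μ : Measure Ω) [IsProbabilityMeasure μ]
    (X : Ω → 𝕏) (Y : Ω → E) (hX : Measurable X) (hY : Measurable Y)
    (P : E → E) (hP : Measurable P) (hPrange : IsClosed (Set.range P))
    (B : E → F) (hB : Measurable B) (hBinj : Set.InjOn B (Set.range P)) :
    (∀ f : 𝕏 → ℝ, Measurable f → (∃ C : ℝ, ∀ x, |f x| ≤ C) →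
        μ[(fun ω => f (X ω)) | MeasurableSpace.comap Y inferInstance]
          =ᵐ[μ]
        μ[(fun ω => f (X ω)) | MeasurableSpace.comap (fun ω => B (P (Y ω))) inferInstance])
      ↔
    CondIndepFun (MeasurableSpace.comap (fun ω => P (Y ω)) inferInstance)
      ((hP.comp hY).comap_le) X (fun ω => Y ω - P (Y ω)) μ := by
  have hPY : Measurable fun ω => P (Y ω) := hP.comp hY
  rw [MeasurableSpace.comap_comp_eq_of_injOn hPrange.measurableSet hB hBinj
      fun ω => Set.mem_range_self (Y ω),
    ← MeasurableSpace.comap_sup_comap_sub Y hP, condIndepFun_iff_condIndep]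
  constructor
  · intro H
    refine condIndep_of_forall_condExp_sup_eq hPY.comap_le hX.comap_le
      (hY.sub hPY).comap_le ?_
    rintro _ ⟨s, hs, rfl⟩
    exact H (s.indicator fun _ => 1) (measurable_const.indicator hs)
      ⟨1, abs_indicator_one_le_one s⟩
  · rintro hind f hf ⟨C, hC⟩
    exact hind.condExp_sup_eq hX.comap_le (hY.sub hPY).comap_le
      (hf.comp (comap_measurable X)).stronglyMeasurable fun ω => hC (X ω)
end

section
/- Let (Ω, 𝒜, μ) be a probability space, let 𝕏, 𝕐, Δ, and 𝔽 be standard Borel spaces, and let X : Ω → 𝕏, Y : Ω → 𝕐, Z : Ω → Δ be measurable, and let B : 𝕐 → 𝔽 be measurable. Assume (a) Z and Y are conditionally independent given X, and (b) for every bounded measurable f : 𝕏 → ℝ one has μ[f ∘ X | σ(Y)] = μ[f ∘ X | σ(B ∘ Y)] μ-almost surely. Then for every bounded measurable g : Δ → ℝ one has μ[g ∘ Z | σ(Y)] = μ[g ∘ Z | σ(B ∘ Y)] μ-almost surely. -/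
open MeasureTheory ProbabilityTheory

/-- If `f` and `h` are conditionally independent given `k`, then the conditional expectation of
`g ∘ f` given the pair `(k, h)` is the integral of `g` against the conditional distribution of `f`
given `k` alone. -/
theorem condExp_prodMk_ae_eq_integral_condDistrib_of_condIndepFun {Ω α β γ : Type*}
    [MeasurableSpace Ω] [StandardBorelSpace Ω]
    [MeasurableSpace α] [StandardBorelSpace α] [Nonempty α]
    [MeasurableSpace β] [StandardBorelSpace β] [Nonempty β] [MeasurableSpace γ]
    {μ : Measure Ω} [IsFiniteMeasure μ] {f : Ω → α} {h : Ω → β} {k : Ω → γ}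
    (hf : Measurable f) (hh : Measurable h) (hk : Measurable k)
    (hfh : CondIndepFun (MeasurableSpace.comap k inferInstance) hk.comap_le f h μ)
    {g : α → ℝ} (hg : Measurable g) (hg_int : Integrable (fun ω => g (f ω)) μ) :
    μ[(fun ω => g (f ω)) | MeasurableSpace.comap (fun ω => (k ω, h ω)) inferInstance]
      =ᵐ[μ] fun ω => ∫ z, g z ∂condDistrib f k μ (k ω) := by
  have hkh : Measurable fun ω => (k ω, h ω) := hk.prodMk hh
  have h_eq := ae_of_ae_map hkh.aemeasurable
    ((condIndepFun_iff_condDistrib_prod_ae_eq_prodMkRight hf hh hk).1 hfh.symm)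
  filter_upwards [condExp_ae_eq_integral_condDistrib hkh hf.aemeasurable hg.stronglyMeasurable
    hg_int, h_eq] with ω h₁ h₂
  rw [h₁, h₂, Kernel.prodMkRight_apply]

/-- **Corollary 7.2.** If `Z` and `Y` are conditionally independent given `X`, and the
conditional expectation of every bounded measurable function of `X` given `Y` agrees with the
one given `B ∘ Y`, then the same holds for bounded measurable functions of `Z`. -/
theorem cor_7_2 {Ω 𝕏 𝕐 Δ 𝔽 : Type*}
    [MeasurableSpace Ω] [StandardBorelSpace Ω]
    [MeasurableSpace 𝕏] [StandardBorelSpace 𝕏]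
    [MeasurableSpace 𝕐] [StandardBorelSpace 𝕐]
    [MeasurableSpace Δ] [StandardBorelSpace Δ]
    [MeasurableSpace 𝔽] [StandardBorelSpace 𝔽]
    (μ : Measure Ω) [IsProbabilityMeasure μ]
    (X : Ω → 𝕏) (Y : Ω → 𝕐) (Z : Ω → Δ)
    (hX : Measurable X) (hY : Measurable Y) (hZ : Measurable Z)
    (B : 𝕐 → 𝔽) (hB : Measurable B)
    (hCI : CondIndepFun (MeasurableSpace.comap X inferInstance) hX.comap_le Z Y μ)
    (hrec : ∀ f : 𝕏 → ℝ, Measurable f → (∃ C : ℝ, ∀ x, |f x| ≤ C) →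
        μ[(fun ω => f (X ω)) | MeasurableSpace.comap Y inferInstance]
          =ᵐ[μ]
        μ[(fun ω => f (X ω)) | MeasurableSpace.comap (fun ω => B (Y ω)) inferInstance]) :
    ∀ g : Δ → ℝ, Measurable g → (∃ C : ℝ, ∀ z, |g z| ≤ C) →
        μ[(fun ω => g (Z ω)) | MeasurableSpace.comap Y inferInstance]
          =ᵐ[μ]
        μ[(fun ω => g (Z ω)) | MeasurableSpace.comap (fun ω => B (Y ω)) inferInstance] := by
  rintro g hg ⟨C, hC⟩
  obtain ⟨ω₀⟩ : Nonempty Ω := nonempty_of_isProbabilityMeasure μ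
  have : Nonempty Δ := ⟨Z ω₀⟩
  have : Nonempty 𝕐 := ⟨Y ω₀⟩
  have hg_int : Integrable (fun ω => g (Z ω)) μ :=
    .of_bound (hg.comp hZ).aestronglyMeasurable C (.of_forall fun ω => hC (Z ω))
  let F : 𝕏 → ℝ := fun x => ∫ z, g z ∂condDistrib Z X μ x
  have hF : Measurable F := hg.stronglyMeasurable.integral_kernel.measurable
  have hF_bound : ∀ x, |F x| ≤ C := fun x => by
    simpa using norm_integral_le_of_norm_le_const (f := g) (μ := condDistrib Z X μ x)
      (.of_forall hC)
  have hXY_le := (hX.prodMk hY).comap_le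
  have hXY := condExp_prodMk_ae_eq_integral_condDistrib_of_condIndepFun hZ hY hX hCI hg hg_int
  have tower : ∀ m ≤ MeasurableSpace.comap (fun ω => (X ω, Y ω)) inferInstance,
      μ[(fun ω => g (Z ω)) | m] =ᵐ[μ] μ[(fun ω => F (X ω)) | m] := fun m hm =>
    (condExp_condExp_of_le hm hXY_le).symm.trans (condExp_congr_ae hXY)
  have hY_comap : Measurable[MeasurableSpace.comap (fun ω => (X ω, Y ω)) inferInstance] Y :=
    measurable_snd.comp (comap_measurable _)
  exact (tower _ hY_comap.comap_le).trans <| (hrec F hF ⟨C, hF_bound⟩).trans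
    (tower _ (hB.comp hY_comap).comap_le).symm
end
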